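/- arXiv:0804.2219 — 2 statements merged into one kernel-verified Lean document; each statement's English description precedes it below -/
import Mathlib

section
/- Let A = ℂ[x_1, x_2, x_3], f = x_1·x_2·(x_1 + x_2)·(x_1 + x_2·x_3), and g_j = ∂f/∂x_j for j = 1, 2, 3. Then s·p ∈ ker^{(1)}φ for every p ∈ ker φ, while ker φ ≠ ker^{(1)}φ. In other words, the 'four lines' divisor satisfies property (GCL) with N = 1 but is not of commutative linear type. -/
open MvPolynomial

set_option synthInstance.maxHeartbeats 1000000
set_option maxHeartbeats 1000000

/-- The `A`-algebra map `φ : A[s, ξ_1, …, ξ_n] → A[t]` with `φ(s) = f·t` and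
`φ(ξ_j) = g_j·t`; variable `0` is `s` and variable `j.succ` is `ξ_j`. Its image is the
Rees algebra of the ideal `(f, g_1, …, g_n)`. -/
noncomputable def reesPhi {A : Type*} [CommRing A] {n : ℕ} (f : A) (g : Fin n → A) :
    MvPolynomial (Fin (n + 1)) A →ₐ[A] Polynomial A :=
  aeval (Fin.cons (Polynomial.C f * Polynomial.X) fun j => Polynomial.C (g j) * Polynomial.X)

/-- `ker^{(1)} φ`: the ideal of `A[s, ξ_1, …, ξ_n]` generated by the homogeneous
elements of degree `1` lying in `ker φ`. -/
noncomputable def kerOne {A : Type*} [CommRing A] {n : ℕ} (f : A) (g : Fin n → A) :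
    Ideal (MvPolynomial (Fin (n + 1)) A) :=
  Ideal.span {p | p ∈ RingHom.ker (reesPhi f g) ∧ p.IsHomogeneous 1}

/-- The equation of the "four lines" divisor in `ℂ^3`:
`f = x_1·x_2·(x_1 + x_2)·(x_1 + x_2·x_3)`. -/
noncomputable def fourLines : MvPolynomial (Fin 3) ℂ :=
  X 0 * X 1 * (X 0 + X 1) * (X 0 + X 1 * X 2)

namespace FourLines

/-! ### The linear relations and their minor over an arbitrary ring -/

section Relations

variable {R : Type*} [CommRing R] (x y z a b c : R)

/-- The relation `(x + y z) ∂_z f = y f`, with `f` written as `x a + y b`. -/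
def relOne : R := x * (c - y * a) + y * (z * c - y * b)

/-- The relation coming from a third logarithmic derivation, with `f` written as
`x a + y b`. -/
def relTwo : R := x * (3 * y * b - (x + 3 * y) * a - (z - 1) * c) + y * (y * b)

/-- The determinant of the coefficients of `x` and `y` in `relOne` and `relTwo`. -/
def relMinor : R :=
  (c - y * a) * (y * b) - (z * c - y * b) * (3 * y * b - (x + 3 * y) * a - (z - 1) * c)

theorem mul_relMinor_left_mem :
    x * relMinor x y z a b c ∈ Ideal.span {relOne x y z a b c, relTwo x y z a b c} :=
  Ideal.mem_span_pair.2 ⟨y * b, -(z * c - y * b), by unfold relOne relTwo relMinor; ring⟩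

theorem mul_relMinor_right_mem :
    y * relMinor x y z a b c ∈ Ideal.span {relOne x y z a b c, relTwo x y z a b c} :=
  Ideal.mem_span_pair.2 ⟨-(3 * y * b - (x + 3 * y) * a - (z - 1) * c), c - y * a,
    by unfold relOne relTwo relMinor; ring⟩

theorem mem_span_triple {u v w p : R} :
    p ∈ Ideal.span {u, v, w} ↔ ∃ α β γ, p = α * u + β * v + γ * w := by
  constructor
  · intro h
    obtain ⟨α, q, hq, rfl⟩ := Ideal.mem_span_insert.1 h
    obtain ⟨β, γ, rfl⟩ := Ideal.mem_span_pair.1 hq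
    exact ⟨α, β, γ, by ring⟩
  · rintro ⟨α, β, γ, rfl⟩
    refine add_mem (add_mem ?_ ?_) ?_ <;>
      exact Ideal.mul_mem_left _ _ (Ideal.subset_span (by simp))

variable {x y z a b c}

theorem mem_of_mul_mem [IsDomain R] (hy : Prime y) (hyx : ¬ y ∣ x)
    (hxy : (Ideal.span {x, y}).IsPrime) (hz : z ∉ Ideal.span {x, y})
    (hz1 : z - 1 ∉ Ideal.span {x, y}) (hc : c ∉ Ideal.span {x, y})
    (hcy : (Ideal.span {c, y}).IsPrime) (hx : x ∉ Ideal.span {c, y})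
    (ha : a ∉ Ideal.span {c, y}) {p : R}
    (hp : y * p ∈ Ideal.span {relOne x y z a b c, relTwo x y z a b c, relMinor x y z a b c}) :
    p ∈ Ideal.span {relOne x y z a b c, relTwo x y z a b c, relMinor x y z a b c} := by
  obtain ⟨α, β, γ, h⟩ := mem_span_triple.1 hp
  have hγ : γ ∈ Ideal.span {x, y} := by
    have : γ * (z * (z - 1) * c * c) ∈ Ideal.span {x, y} := by
      refine Ideal.mem_span_pair.2
        ⟨-(α * (c - y * a) + β * (3 * y * b - (x + 3 * y) * a - (z - 1) * c))
          - γ * (z * c) * a,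
        p - (α * (z * c - y * b) + β * (y * b)) - γ * ((c - y * a) * b - (z * c) * (3 * b - 3 * a)
          + b * (3 * y * b - (x + 3 * y) * a - (z - 1) * c)), ?_⟩
      unfold relOne relTwo relMinor at h
      linear_combination h
    refine (hxy.mem_or_mem this).resolve_right fun h' => ?_
    rcases hxy.mem_or_mem h' with h' | h'
    · rcases hxy.mem_or_mem h' with h' | h'
      · rcases hxy.mem_or_mem h' with h' | h'
        exacts [hz h', hz1 h']
      · exact hc h'
    · exact hc h'
  obtain ⟨γ₁, γ₂, rfl⟩ := Ideal.mem_span_pair.1 hγ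
  obtain ⟨μ, ν, hμ⟩ := Ideal.mem_span_pair.1 (mul_relMinor_left_mem x y z a b c)
  have h₁ : y * (p - γ₂ * relMinor x y z a b c) =
      (α + γ₁ * μ) * relOne x y z a b c + (β + γ₁ * ν) * relTwo x y z a b c := by
    linear_combination h - γ₁ * hμ
  generalize α + γ₁ * μ = α' at h₁
  generalize β + γ₁ * ν = β' at h₁
  have h₂ : y ∣ α' * c - β' * (x * a + (z - 1) * c) := by
    refine (hy.dvd_or_dvd (?_ : y ∣ x * _)).resolve_left hyx
    refine ⟨p - γ₂ * relMinor x y z a b c + α' * x * a - α' * (z * c - y * b)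
      - β' * (3 * x * b - 3 * x * a + y * b), ?_⟩
    unfold relOne relTwo at h₁
    linear_combination -h₁
  obtain ⟨δ, hδ⟩ := h₂
  have hβ : β' ∈ Ideal.span {c, y} := by
    have : β' * (x * a) ∈ Ideal.span {c, y} :=
      Ideal.mem_span_pair.2 ⟨α' - β' * (z - 1), -δ, by linear_combination hδ⟩
    refine (hcy.mem_or_mem this).resolve_right fun h' => ?_
    rcases hcy.mem_or_mem h' with h' | h'
    exacts [hx h', ha h']
  obtain ⟨β₁, β₂, rfl⟩ := Ideal.mem_span_pair.1 hβ
  have h₃ : y ∣ α' - β₁ * (x * a + (z - 1) * c) := by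
    have hyc : ¬ y ∣ c := fun ⟨k, hk⟩ => hc (Ideal.mem_span_pair.2 ⟨0, k, by rw [hk]; ring⟩)
    refine (hy.dvd_or_dvd (?_ : y ∣ _ * c)).resolve_right hyc
    exact ⟨δ + β₂ * (x * a + (z - 1) * c), by linear_combination hδ⟩
  obtain ⟨ε, hε⟩ := h₃
  refine mem_span_triple.2 ⟨ε + β₁ * 3 * (b - a), β₂ + β₁ * a, γ₂ + β₁, ?_⟩
  refine mul_left_cancel₀ hy.ne_zero ?_
  unfold relOne relTwo relMinor at *
  linear_combination h₁ + (x * (c - y * a) + y * (z * c - y * b)) * hε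

end Relations

theorem dvd_of_dvd_pow_mul {R : Type*} [CommRing R] [IsDomain R] {q h p : R} (hq : Prime q)
    (hqh : ¬ q ∣ h) {k : ℕ} (hp : h ∣ q ^ k * p) : h ∣ p := by
  induction k with
  | zero => simpa using hp
  | succ k ih =>
    refine ih ?_
    obtain ⟨α, hα⟩ := hp
    have hqα : q ∣ h * α := ⟨q ^ k * p, by rw [← hα]; ring⟩
    obtain ⟨β, rfl⟩ := (hq.dvd_or_dvd hqα).resolve_left hqh
    exact ⟨β, mul_left_cancel₀ hq.ne_zero (by linear_combination hα)⟩

/-- Elimination of variables after multiplication by a power of `h`. -/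
theorem exists_pow_mul_sub_mem {R P σ : Type*} [CommRing R] [CommRing P] [Algebra R P]
    {S : Subalgebra R P} {I : Ideal P} {h : P} (hS : h ∈ S) (ψ : MvPolynomial σ R →ₐ[R] P)
    (hX : ∀ i, ∃ N : ℕ, ∃ q ∈ S, h ^ N * ψ (X i) - q ∈ I) (p : MvPolynomial σ R) :
    ∃ N : ℕ, ∃ q ∈ S, h ^ N * ψ p - q ∈ I := by
  induction p using MvPolynomial.induction_on with
  | C r => exact ⟨0, _, S.algebraMap_mem r, by
      rw [pow_zero, one_mul, ← algebraMap_eq, AlgHom.commutes, sub_self]; exact I.zero_mem⟩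
  | add p p' hp hp' =>
    obtain ⟨N, q, hq, e⟩ := hp
    obtain ⟨M, q', hq', e'⟩ := hp'
    refine ⟨N + M, h ^ M * q + h ^ N * q',
      add_mem (mul_mem (pow_mem hS _) hq) (mul_mem (pow_mem hS _) hq'), ?_⟩
    convert add_mem (I.mul_mem_left (h ^ M) e) (I.mul_mem_left (h ^ N) e') using 1
    rw [map_add]; ring
  | mul_X p i hp =>
    obtain ⟨N, q, hq, e⟩ := hp
    obtain ⟨M, q', hq', e'⟩ := hX i
    refine ⟨N + M, q * q', mul_mem hq hq', ?_⟩
    convert add_mem (I.mul_mem_left q' e) (I.mul_mem_left (h ^ N * ψ p) e') using 1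
    rw [map_mul]; ring

theorem isPrime_of_sub_mem {P : Type*} [CommRing P] [IsDomain P] {I : Ideal P} (ρ : P →+* P)
    (hI : I ≤ RingHom.ker ρ) (hρ : (Ideal.Quotient.mk I).comp ρ = Ideal.Quotient.mk I) :
    I.IsPrime := by
  have : I = RingHom.ker ρ := by
    refine le_antisymm hI fun p hp => ?_
    rw [← Ideal.Quotient.eq_zero_iff_mem, ← hρ, RingHom.comp_apply, RingHom.mem_ker.1 hp, map_zero]
  exact this ▸ RingHom.ker_isPrime ρ

/-! ### The polynomial ring `ℂ[x_1, x_2, x_3][s, ξ_1, ξ_2, ξ_3]` -/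

/-- The ring `ℂ[x_1, x_2, x_3][s, ξ_1, ξ_2, ξ_3]`. -/
abbrev P := MvPolynomial (Fin 4) (MvPolynomial (Fin 3) ℂ)

/-- Evaluation of all seven variables. -/
noncomputable def ev {R : Type*} [CommRing R] [Algebra ℂ R] (v : Fin 3 → R) (w : Fin 4 → R) :
    P →+* R :=
  eval₂Hom (aeval v : MvPolynomial (Fin 3) ℂ →ₐ[ℂ] R) w

section ev

variable {R : Type*} [CommRing R] [Algebra ℂ R] (v : Fin 3 → R) (w : Fin 4 → R)

@[simp] theorem ev_C (p : MvPolynomial (Fin 3) ℂ) : ev v w (C p) = aeval v p := by simp [ev]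

@[simp] theorem ev_X (i : Fin 4) : ev v w (X i) = w i := by simp [ev]

end ev

theorem isPrime_of_ev {I : Ideal P} (v : Fin 3 → P) (w : Fin 4 → P)
    (hI : I ≤ RingHom.ker (ev v w)) (hv : ∀ i, C (X i) - v i ∈ I) (hw : ∀ i, X i - w i ∈ I) :
    I.IsPrime := by
  refine isPrime_of_sub_mem (ev v w) hI (MvPolynomial.ringHom_ext' (MvPolynomial.ringHom_ext ?_ ?_)
    ?_)
  · intro r
    simp only [RingHom.comp_apply, ev_C, aeval_C]
    rfl
  · intro i
    simpa using (Ideal.Quotient.eq.2 (hv i)).symm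
  · intro i
    simpa using (Ideal.Quotient.eq.2 (hw i)).symm

/-- The coordinate `x_1` in `P`. -/
noncomputable abbrev x : P := C (X 0)

/-- The coordinate `x_2` in `P`. -/
noncomputable abbrev y : P := C (X 1)

/-- The coordinate `x_3` in `P`. -/
noncomputable abbrev z : P := C (X 2)

/-- The scalar `1 / 4`. -/
noncomputable abbrev κ : P := C (C (1 / 4))

theorem C_two : (C 2 : P) = 2 := map_ofNat C 2

theorem C_three : (C 3 : P) = 3 := map_ofNat C 3

theorem C_four : (C 4 : P) = 4 := map_ofNat C 4

theorem four_mul_κ : 4 * κ = 1 := by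
  have h : (4 : P) = C (C 4) := by rw [← C_four]; exact congrArg C (map_ofNat C 4).symm
  rw [h, ← C_mul, ← C_mul]
  norm_num

theorem notMem_of_ev {I : Ideal P} {p : P} (v : Fin 3 → ℂ) (w : Fin 4 → ℂ)
    (hI : I ≤ RingHom.ker (ev v w)) (hp : ev v w p ≠ 0) : p ∉ I :=
  fun h => hp (hI h)

theorem isPrime_span_x_y : (Ideal.span {x, y}).IsPrime := by
  refine isPrime_of_ev ![0, 0, z] X ?_ ?_ ?_
  · rw [Ideal.span_le]; rintro _ (rfl | rfl) <;> simp [RingHom.mem_ker]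
  · intro i
    fin_cases i
    · exact Ideal.subset_span (by simp)
    · exact Ideal.subset_span (by simp)
    · simp
  · simp

theorem isPrime_span_X_y : (Ideal.span {X 3, y}).IsPrime := by
  refine isPrime_of_ev ![x, 0, z] ![X 0, X 1, X 2, 0] ?_ ?_ ?_
  · rw [Ideal.span_le]; rintro _ (rfl | rfl) <;> simp [RingHom.mem_ker]
  · intro i
    fin_cases i
    · simp
    · exact Ideal.subset_span (by simp)
    · simp
  · intro i
    fin_cases i
    · simp
    · simp
    · simp
    · exact Ideal.subset_span (by simp)

theorem prime_x : Prime x := by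
  rw [← Ideal.span_singleton_prime (by simp)]
  refine isPrime_of_ev ![0, y, z] X ?_ ?_ (by simp)
  · rw [Ideal.span_le]; rintro _ rfl; simp [RingHom.mem_ker]
  · intro i
    fin_cases i
    · exact Ideal.subset_span (by simp)
    · simp
    · simp

theorem prime_y : Prime y := by
  rw [← Ideal.span_singleton_prime (by simp)]
  refine isPrime_of_ev ![x, 0, z] X ?_ ?_ (by simp)
  · rw [Ideal.span_le]; rintro _ rfl; simp [RingHom.mem_ker]
  · intro i
    fin_cases i
    · simp
    · exact Ideal.subset_span (by simp)
    · simp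

theorem prime_x_add_y : Prime (x + y) := by
  rw [← Ideal.span_singleton_prime]
  · refine isPrime_of_ev ![-y, y, z] X ?_ ?_ (by simp)
    · rw [Ideal.span_le]; rintro _ rfl; simp [RingHom.mem_ker]
    · intro i
      fin_cases i
      · exact Ideal.subset_span (by simp)
      · simp
      · simp
  · intro h
    simpa using congrArg (ev (R := ℂ) ![1, 0, 0] 0) h

theorem not_dvd_of_ev {q p : P} (v : Fin 3 → ℂ) (w : Fin 4 → ℂ) (hq : ev v w q = 0)
    (hp : ev v w p ≠ 0) : ¬ q ∣ p := by
  rintro ⟨k, rfl⟩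
  simp [hq] at hp

/-! ### The map `φ` -/

/-- The Rees map of the four lines divisor. -/
noncomputable abbrev phi : P →ₐ[MvPolynomial (Fin 3) ℂ] Polynomial (MvPolynomial (Fin 3) ℂ) :=
  reesPhi fourLines fun j => pderiv j fourLines

/-- The partial derivative of `f / y` with respect to `x`. -/
noncomputable abbrev dx : MvPolynomial (Fin 3) ℂ :=
  3 * X 0 ^ 2 + 2 * X 0 * X 1 + 2 * X 0 * X 1 * X 2 + X 1 ^ 2 * X 2

theorem C_dx : C dx = 3 * x ^ 2 + 2 * x * y + 2 * x * y * z + y ^ 2 * z := by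
  simp only [map_add, map_mul, map_pow, C_two, C_three]

theorem pderiv_zero_fourLines : pderiv 0 fourLines = X 1 * dx := by
  simp only [fourLines, Derivation.leibniz, map_add, pderiv_X, smul_eq_mul, Pi.single_apply]
  simp
  ring

theorem pderiv_one_fourLines : pderiv 1 fourLines =
    X 0 * (X 0 ^ 2 + 2 * X 0 * X 1 * (1 + X 2) + 3 * X 1 ^ 2 * X 2) := by
  simp only [fourLines, Derivation.leibniz, map_add, pderiv_X, smul_eq_mul, Pi.single_apply]
  simp
  ring

theorem pderiv_two_fourLines : pderiv 2 fourLines = X 0 * X 1 ^ 2 * (X 0 + X 1) := by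
  simp only [fourLines, Derivation.leibniz, map_add, pderiv_X, smul_eq_mul, Pi.single_apply]
  simp
  ring

theorem phi_C (p : MvPolynomial (Fin 3) ℂ) : phi (C p) = Polynomial.C p :=
  phi.commutes p

theorem phi_X_zero : phi (X 0) = Polynomial.C fourLines * Polynomial.X := by
  simp [phi, reesPhi]

theorem phi_X_one : phi (X 1) = Polynomial.C (X 1 * dx) * Polynomial.X := by
  rw [← pderiv_zero_fourLines]
  exact aeval_X _ 1

theorem phi_X_two : phi (X 2) = Polynomial.C
    (X 0 * (X 0 ^ 2 + 2 * X 0 * X 1 * (1 + X 2) + 3 * X 1 ^ 2 * X 2)) * Polynomial.X := by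
  rw [← pderiv_one_fourLines]
  exact aeval_X _ 2

theorem phi_X_three : phi (X 3) =
    Polynomial.C (X 0 * X 1 ^ 2 * (X 0 + X 1)) * Polynomial.X := by
  rw [← pderiv_two_fourLines]
  exact aeval_X _ 3

/-- The relation `x ξ_1 + y ξ_2 = 4 s`, divided by `4`. -/
noncomputable abbrev euler : P := x * (κ * X 1) + y * (κ * X 2) - X 0

/-- `relOne` in the variables of `P`. -/
noncomputable abbrev g₁ : P := relOne x y z (κ * X 1) (κ * X 2) (X 3)

/-- `relTwo` in the variables of `P`. -/
noncomputable abbrev g₂ : P := relTwo x y z (κ * X 1) (κ * X 2) (X 3)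

/-- `relMinor` in the variables of `P`. -/
noncomputable abbrev Δ : P := relMinor x y z (κ * X 1) (κ * X 2) (X 3)

/-- The relation between `∂_x f` and `∂_z f`. -/
noncomputable abbrev g₃ : P := C dx * X 3 - x * y * (x + y) * X 1

theorem phi_κ : 4 * phi κ = 1 := by
  simpa only [map_mul, map_ofNat, map_one] using congrArg phi four_mul_κ

theorem phi_euler : phi euler = 0 := by
  simp only [map_sub, map_add, map_mul, phi_X_zero, phi_X_one, phi_X_two, phi_C, fourLines,
    map_pow, map_ofNat, map_one]
  have h := phi_κ
  rw [phi_C] at h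
  grind

theorem phi_g₁ : phi g₁ = 0 := by
  simp only [relOne, map_sub, map_add, map_mul, phi_X_one, phi_X_two, phi_X_three,
    phi_C, map_pow, map_ofNat, map_one]
  have h := phi_κ
  rw [phi_C] at h
  grind

theorem phi_g₂ : phi g₂ = 0 := by
  simp only [relTwo, map_sub, map_add, map_mul, phi_X_one, phi_X_two, phi_X_three,
    phi_C, map_pow, map_ofNat, map_one]
  have h := phi_κ
  rw [phi_C] at h
  grind

theorem phi_g₃ : phi g₃ = 0 := by
  simp only [map_sub, map_add, map_mul, phi_X_one, phi_X_three, phi_C, map_pow, map_ofNat]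
  ring

theorem phi_Δ : phi Δ = 0 := by
  have h := mul_relMinor_right_mem x y z (κ * X 1) (κ * X 2) (X 3)
  obtain ⟨α, β, h⟩ := Ideal.mem_span_pair.1 h
  have := congrArg phi h
  simpa [phi_g₁, phi_g₂, phi_C] using this

/-! ### The kernel of `φ` -/

/-- Elimination of `s` by means of `euler`. -/
noncomputable def psi : P →ₐ[MvPolynomial (Fin 3) ℂ] P :=
  aeval ![x * (κ * X 1) + y * (κ * X 2), X 1, X 2, X 3]

theorem psi_sub_mem (p : P) : psi p - p ∈ Ideal.span {euler} := by
  have : (Ideal.Quotient.mkₐ (MvPolynomial (Fin 3) ℂ) (Ideal.span {euler})).comp psi =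
      Ideal.Quotient.mkₐ (MvPolynomial (Fin 3) ℂ) (Ideal.span {euler}) := by
    refine MvPolynomial.algHom_ext fun i => Ideal.Quotient.eq.2 ?_
    fin_cases i
    · exact Ideal.subset_span (by simp [psi])
    all_goals simp [psi]
  exact Ideal.Quotient.eq.1 (DFunLike.congr_fun this p)

theorem phi_psi (p : P) : phi (psi p) = phi p := by
  obtain ⟨k, hk⟩ := Ideal.mem_span_singleton.1 (psi_sub_mem p)
  rw [← sub_eq_zero, ← map_sub, hk, map_mul, phi_euler, zero_mul]

theorem exists_pow_y_mul (p : P) : ∃ N : ℕ, ∃ q : MvPolynomial (Fin 2) (MvPolynomial (Fin 3) ℂ),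
    y ^ N * psi p - aeval ![(X 1 : P), X 3] q ∈ Ideal.span {g₁} := by
  suffices ∃ N : ℕ, ∃ q ∈ (aeval ![(X 1 : P), X 3] :
      MvPolynomial (Fin 2) (MvPolynomial (Fin 3) ℂ) →ₐ[_] P).range,
      y ^ N * psi p - q ∈ Ideal.span {g₁} by
    obtain ⟨N, _, ⟨q, rfl⟩, h⟩ := this
    exact ⟨N, q, h⟩
  refine exists_pow_mul_sub_mem (Subalgebra.algebraMap_mem _ (X 1)) psi ?_ p
  intro i
  have h4 := four_mul_κ
  fin_cases i
  · refine ⟨1, _, ⟨C (X 0 + X 1 * X 2) * X 1, rfl⟩, Ideal.mem_span_singleton.2 ⟨-1, ?_⟩⟩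
    simp [psi, relOne, algebraMap_eq]
    ring
  · exact ⟨0, _, ⟨X 0, rfl⟩, by simp [psi]⟩
  · refine ⟨2, _, ⟨C (4 * (X 0 + X 1 * X 2)) * X 1 - C (X 0 * X 1) * X 0, rfl⟩,
      Ideal.mem_span_singleton.2 ⟨-4, ?_⟩⟩
    simp [psi, relOne, algebraMap_eq]
    rw [C_four]
    linear_combination -(y * y * X 2 + x * y * X 1) * h4
  · exact ⟨0, _, ⟨X 1, rfl⟩, by simp [psi]⟩

theorem eq_zero_of_phi_aeval_eq_zero {q : Polynomial (MvPolynomial (Fin 3) ℂ)}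
    (hq : phi (Polynomial.aeval (X 3) q) = 0) : q = 0 := by
  have hd : (X 0 * X 1 ^ 2 * (X 0 + X 1) : MvPolynomial (Fin 3) ℂ) ≠ 0 := fun h => by
    simpa using congrArg (eval (1 : Fin 3 → ℂ)) h
  rw [← Polynomial.aeval_algHom_apply, phi_X_three] at hq
  exact (Polynomial.comp_C_mul_X_eq_zero_iff (mem_nonZeroDivisors_of_ne_zero hd)).1 hq

theorem g₃_dvd {q : MvPolynomial (Fin 2) (MvPolynomial (Fin 3) ℂ)}
    (hq : phi (aeval ![(X 1 : P), X 3] q) = 0) : g₃ ∣ aeval ![(X 1 : P), X 3] q := by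
  obtain ⟨N, _, ⟨r, rfl⟩, h⟩ : ∃ N : ℕ, ∃ r ∈ (Polynomial.aeval (X 3 : P) :
      Polynomial (MvPolynomial (Fin 3) ℂ) →ₐ[_] P).range,
      (x * y * (x + y)) ^ N * aeval ![(X 1 : P), X 3] q - r ∈ Ideal.span {g₃} := by
    refine exists_pow_mul_sub_mem (h := x * y * (x + y)) ?_ _ ?_ q
    · exact ⟨Polynomial.C (X 0 * X 1 * (X 0 + X 1)), by simp [algebraMap_eq]⟩
    intro i
    fin_cases i
    · refine ⟨1, _, ⟨Polynomial.C dx * Polynomial.X, rfl⟩, Ideal.mem_span_singleton.2 ⟨-1, ?_⟩⟩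
      simp only [AlgHom.toRingHom_eq_coe, RingHom.coe_coe, map_mul, Polynomial.aeval_C,
        Polynomial.aeval_X, aeval_X, algebraMap_eq, Fin.zero_eta, Matrix.cons_val_zero]
      ring
    · exact ⟨0, _, ⟨Polynomial.X, rfl⟩, by simp⟩
  rw [Ideal.mem_span_singleton] at h
  change g₃ ∣ _ - Polynomial.aeval (X 3) r at h
  have hr : r = 0 := by
    refine eq_zero_of_phi_aeval_eq_zero ?_
    obtain ⟨k, hk⟩ := h
    have := congrArg phi hk
    rwa [map_sub, map_mul, map_mul, hq, phi_g₃, mul_zero, zero_mul, zero_sub, neg_eq_zero] at this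
  rw [hr, map_zero, sub_zero] at h
  have h' : g₃ ∣ x ^ N * (y ^ N * ((x + y) ^ N * aeval ![(X 1 : P), X 3] q)) := by
    convert h using 1
    rw [mul_pow, mul_pow]
    ring
  refine dvd_of_dvd_pow_mul prime_x_add_y ?_ (dvd_of_dvd_pow_mul prime_y ?_
    (dvd_of_dvd_pow_mul prime_x ?_ h'))
  · exact not_dvd_of_ev ![1, -1, 0] 1 (by simp) (by simp; norm_num)
  · exact not_dvd_of_ev ![1, 0, 0] 1 (by simp) (by simp)
  · exact not_dvd_of_ev ![0, 1, 1] 1 (by simp) (by simp)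

theorem mem_of_pow_y_mul_mem {p : P} {N : ℕ} (h : y ^ N * p ∈ Ideal.span {g₁, g₂, Δ}) :
    p ∈ Ideal.span {g₁, g₂, Δ} := by
  induction N with
  | zero => simpa using h
  | succ N ih =>
    refine ih (mem_of_mul_mem prime_y ?_ isPrime_span_x_y ?_ ?_ ?_ isPrime_span_X_y ?_ ?_
      (by rwa [← mul_assoc, ← pow_succ']))
    · exact not_dvd_of_ev ![1, 0, 0] 1 (by simp) (by simp)
    · refine notMem_of_ev ![0, 0, 1] 1 ?_ (by simp)
      rw [Ideal.span_le]; rintro _ (rfl | rfl) <;> simp [RingHom.mem_ker]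
    · refine notMem_of_ev ![0, 0, 0] 1 ?_ (by simp)
      rw [Ideal.span_le]; rintro _ (rfl | rfl) <;> simp [RingHom.mem_ker]
    · refine notMem_of_ev ![0, 0, 0] 1 ?_ (by simp)
      rw [Ideal.span_le]; rintro _ (rfl | rfl) <;> simp [RingHom.mem_ker]
    · refine notMem_of_ev ![1, 0, 0] 0 ?_ (by simp)
      rw [Ideal.span_le]; rintro _ (rfl | rfl) <;> simp [RingHom.mem_ker]
    · refine notMem_of_ev ![1, 0, 0] ![0, 1, 0, 0] ?_ (by simp)
      rw [Ideal.span_le]; rintro _ (rfl | rfl) <;> simp [RingHom.mem_ker]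

theorem psi_mem_of_phi_eq_zero {p : P} (hp : phi p = 0) : psi p ∈ Ideal.span {g₁, g₂, Δ} := by
  obtain ⟨N, q, h⟩ := exists_pow_y_mul p
  obtain ⟨k, hk⟩ := Ideal.mem_span_singleton.1 h
  have hq : phi (aeval ![(X 1 : P), X 3] q) = 0 := by
    have := congrArg phi hk
    rwa [map_sub, map_mul, phi_psi, hp, mul_zero, map_mul, phi_g₁, zero_mul, zero_sub,
      neg_eq_zero] at this
  obtain ⟨m, hm⟩ := g₃_dvd hq
  have hg : y * g₂ + (y + 3 * x) * g₁ = g₃ := by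
    have h4 := four_mul_κ
    simp only [relOne, relTwo]
    linear_combination -X 3 * C_dx + (-x * y * (x + y) * X 1) * h4
  refine mem_of_pow_y_mul_mem (N := N) (mem_span_triple.2
    ⟨k + (y + 3 * x) * m, y * m, 0, ?_⟩)
  linear_combination hk + hm - m * hg

theorem euler_mem : euler ∈ kerOne fourLines fun j => pderiv j fourLines := by
  refine Ideal.subset_span ⟨phi_euler, ?_⟩
  have : euler = C (X 0 * C (1 / 4)) * X 1 + C (X 1 * C (1 / 4)) * X 2 - X 0 := by
    simp only [C_mul]; ring
  rw [this]
  exact ((isHomogeneous_C_mul_X _ _).add (isHomogeneous_C_mul_X _ _)).sub (isHomogeneous_X _ _)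

theorem g₁_mem : g₁ ∈ kerOne fourLines fun j => pderiv j fourLines := by
  refine Ideal.subset_span ⟨phi_g₁, ?_⟩
  have : g₁ = C (-X 0 * X 1 * C (1 / 4)) * X 1 + C (-X 1 * X 1 * C (1 / 4)) * X 2 +
      C (X 0 + X 1 * X 2) * X 3 := by
    simp only [relOne, C_mul, C_add, C_neg]; ring
  rw [this]
  exact ((isHomogeneous_C_mul_X _ _).add (isHomogeneous_C_mul_X _ _)).add
    (isHomogeneous_C_mul_X _ _)

theorem g₂_mem : g₂ ∈ kerOne fourLines fun j => pderiv j fourLines := by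
  refine Ideal.subset_span ⟨phi_g₂, ?_⟩
  have : g₂ = C (-X 0 * (X 0 + 3 * X 1) * C (1 / 4)) * X 1 +
      C ((3 * X 0 * X 1 + X 1 * X 1) * C (1 / 4)) * X 2 + C (-X 0 * (X 2 - 1)) * X 3 := by
    simp only [relTwo, C_mul, C_add, C_neg, C_sub, C_1, map_ofNat]; ring
  rw [this]
  exact ((isHomogeneous_C_mul_X _ _).add (isHomogeneous_C_mul_X _ _)).add
    (isHomogeneous_C_mul_X _ _)

theorem span_le_kerOne :
    Ideal.span {g₁, g₂} ≤ kerOne fourLines fun j => pderiv j fourLines := by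
  rw [Ideal.span_le]
  rintro _ (rfl | rfl)
  exacts [g₁_mem, g₂_mem]

/-- A ring homomorphism vanishing on `kerOne` but not on `Δ`. -/
noncomputable abbrev test : P →+* Polynomial ℂ := ev ![0, 0, 2] ![0, 0, 0, Polynomial.X]

theorem test_psi (p : P) : test (psi p) = test p := by
  obtain ⟨k, hk⟩ := Ideal.mem_span_singleton.1 (psi_sub_mem p)
  rw [← sub_eq_zero, ← map_sub, hk, map_mul]
  simp

theorem test_Δ : test Δ = 2 * Polynomial.X ^ 2 := by
  simp [relMinor]
  ring

theorem test_eq_zero {p : P} (hp : p ∈ kerOne fourLines fun j => pderiv j fourLines) :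
    test p = 0 := by
  refine (Ideal.span_le (I := RingHom.ker test)).2 ?_ hp
  rintro p ⟨hp, hp1⟩
  obtain ⟨α, β, γ, h⟩ := mem_span_triple.1 (psi_mem_of_phi_eq_zero hp)
  have h2 : test p = test γ * (2 * Polynomial.X ^ 2) := by
    rw [← test_psi, h, map_add, map_add, map_mul, map_mul, map_mul, test_Δ]
    simp [relOne, relTwo]
  rw [← mem_homogeneousSubmodule, homogeneousSubmodule_one_eq_span_X,
    Submodule.mem_span_range_iff_exists_fun] at hp1
  obtain ⟨c, rfl⟩ := hp1
  have heval : (aeval ![0, 0, 2] : MvPolynomial (Fin 3) ℂ →ₐ[ℂ] Polynomial ℂ) =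
      Polynomial.CAlgHom.comp (aeval ![0, 0, 2]) := by
    refine MvPolynomial.algHom_ext fun i => ?_
    fin_cases i
    · simp
    · simp
    · simp only [Fin.reduceFinMk, aeval_X, AlgHom.comp_apply, Polynomial.CAlgHom_apply]
      exact (map_ofNat Polynomial.C 2).symm
  have h1 : test (∑ i, c i • X i) = Polynomial.C (eval ![0, 0, 2] (c 3)) * Polynomial.X := by
    simp [Fin.sum_univ_four, smul_eq_C_mul]
    exact DFunLike.congr_fun heval (c 3)
  have h0 : (Polynomial.C (eval ![0, 0, 2] (c 3)) * Polynomial.X : Polynomial ℂ).coeff 1 = 0 := by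
    rw [← h1, h2, show test γ * (2 * Polynomial.X ^ 2) = (test γ * 2) * Polynomial.X ^ 2 by ring,
      Polynomial.coeff_mul_X_pow']
    simp
  rw [SetLike.mem_coe, RingHom.mem_ker, h1]
  simp at h0
  simp [h0]

end FourLines

/-- For the "four lines" divisor, with `g_j = ∂f/∂x_j`, one has
`s·p ∈ ker^{(1)}φ` for every `p ∈ ker φ`, while `ker φ ≠ ker^{(1)}φ`: property (GCL)
holds with `N = 1` but the divisor is not of commutative linear type. -/
theorem fourLines_GCL_not_linear_type :
    (∀ p ∈ RingHom.ker (reesPhi fourLines fun j => pderiv j fourLines),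
      (X 0 : MvPolynomial (Fin 4) (MvPolynomial (Fin 3) ℂ)) * p ∈
        kerOne fourLines fun j => pderiv j fourLines) ∧
    RingHom.ker (reesPhi fourLines fun j => pderiv j fourLines) ≠
      kerOne fourLines fun j => pderiv j fourLines := by
  refine ⟨fun p hp => ?_, fun h => ?_⟩
  · obtain ⟨k, hk⟩ := Ideal.mem_span_singleton.1 (FourLines.psi_sub_mem p)
    obtain ⟨α, β, γ, h⟩ := FourLines.mem_span_triple.1 (FourLines.psi_mem_of_phi_eq_zero hp)
    have hΔ : (FourLines.x * (FourLines.κ * X 1) + FourLines.y * (FourLines.κ * X 2)) *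
        FourLines.Δ ∈ kerOne fourLines fun j => pderiv j fourLines := by
      rw [show (FourLines.x * (FourLines.κ * X 1) + FourLines.y * (FourLines.κ * X 2)) *
        FourLines.Δ = FourLines.κ * X 1 * (FourLines.x * FourLines.Δ) +
          FourLines.κ * X 2 * (FourLines.y * FourLines.Δ) by ring]
      exact add_mem
        (Ideal.mul_mem_left _ _ (FourLines.span_le_kerOne (FourLines.mul_relMinor_left_mem _ _ _ _ _ _)))
        (Ideal.mul_mem_left _ _ (FourLines.span_le_kerOne (FourLines.mul_relMinor_right_mem _ _ _ _ _ _)))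
    have e : X 0 * p = X 0 * α * FourLines.g₁ + X 0 * β * FourLines.g₂ +
        γ * ((FourLines.x * (FourLines.κ * X 1) + FourLines.y * (FourLines.κ * X 2)) *
          FourLines.Δ) + (-γ * FourLines.Δ - X 0 * k) * FourLines.euler := by
      linear_combination X 0 * h - X 0 * hk
    rw [e]
    exact add_mem (add_mem (add_mem (Ideal.mul_mem_left _ _ FourLines.g₁_mem)
      (Ideal.mul_mem_left _ _ FourLines.g₂_mem)) (Ideal.mul_mem_left _ _ hΔ))
      (Ideal.mul_mem_left _ _ FourLines.euler_mem)
  · have hΔ := FourLines.test_eq_zero (h.le (RingHom.mem_ker.2 FourLines.phi_Δ))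
    rw [FourLines.test_Δ] at hΔ
    simp at hΔ
end

section
/- Let A = ℂ[x_1, x_2, x_3], f = x_1·x_2·(x_1 + x_2)·(x_1 + x_2·x_3), and g_j = ∂f/∂x_j for j = 1, 2, 3. Then ker φ = (ker^{(1)}φ : f), i.e. for every p ∈ A[s, ξ_1, ξ_2, ξ_3] one has p ∈ ker φ if and only if f·p ∈ ker^{(1)}φ. -/
open MvPolynomial

set_option synthInstance.maxHeartbeats 1000000
set_option maxHeartbeats 1000000

/-- If every `X i` is proportional to `X i₀` modulo `I`, with ratio `G i / G i₀`, then the kernel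
of `X i ↦ G i * t` is contained in `I` after inverting `G i₀`. -/
theorem exists_C_pow_mul_mem_of_aeval_eq_zero {A σ : Type*} [CommRing A] (G : σ → A) (i₀ : σ)
    (I : Ideal (MvPolynomial σ A))
    (hI : ∀ i, C (G i₀) * X i - C (G i) * X i₀ ∈ I) {p : MvPolynomial σ A}
    (hp : aeval (fun i => Polynomial.C (G i) * Polynomial.X) p = (0 : Polynomial A)) :
    ∃ N : ℕ, C (G i₀) ^ N * p ∈ I := by
  let c : MvPolynomial σ A ⧸ I := Ideal.Quotient.mk I (C (G i₀))
  let L := Localization.Away c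
  let π : MvPolynomial σ A →+* L := (algebraMap _ L).comp (Ideal.Quotient.mk I)
  let ψ : Polynomial A →+* L := Polynomial.eval₂RingHom (π.comp C)
    (π (X i₀) * IsLocalization.Away.invSelf c)
  have hinv : π (C (G i₀)) * IsLocalization.Away.invSelf c = 1 :=
    IsLocalization.Away.mul_invSelf c
  have hψ : ψ.comp (aeval (fun i => Polynomial.C (G i) * Polynomial.X) :
      MvPolynomial σ A →ₐ[A] Polynomial A).toRingHom = π := by
    refine MvPolynomial.ringHom_ext (fun r => ?_) (fun i => ?_)
    · simp [ψ]
    · have h : π (C (G i₀)) * π (X i) = π (C (G i)) * π (X i₀) := by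
        rw [← map_mul, ← map_mul]
        exact congrArg (algebraMap (_ ⧸ I) L) (Ideal.Quotient.eq.2 (hI i))
      simp only [AlgHom.toRingHom_eq_coe, RingHom.comp_apply, RingHom.coe_coe, aeval_X, ψ,
        Polynomial.coe_eval₂RingHom, Polynomial.eval₂_mul, Polynomial.eval₂_C, Polynomial.eval₂_X]
      linear_combination (-IsLocalization.Away.invSelf c) * h + π (X i) * hinv
  have h0 : algebraMap _ L (Ideal.Quotient.mk I p) = 0 := by
    change π p = 0
    rw [← hψ]
    simp only [AlgHom.toRingHom_eq_coe, RingHom.comp_apply, RingHom.coe_coe, hp, map_zero]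
  obtain ⟨⟨_, N, rfl⟩, hm⟩ := (IsLocalization.map_eq_zero_iff (Submonoid.powers c) L _).1 h0
  refine ⟨N, Ideal.Quotient.eq_zero_iff_mem.1 ?_⟩
  simpa only [map_mul, map_pow] using hm

/-- The ideal of maximal minors of the matrix with rows `(-y, x)`, `(a, b)`, `(c, d)`. -/
def minorIdeal {R : Type*} [CommRing R] (x y a b c d : R) : Ideal R :=
  Ideal.span {x * a + y * b, x * c + y * d, a * d - b * c}

theorem mem_minorIdeal {R : Type*} [CommRing R] {x y a b c d q : R} :
    q ∈ minorIdeal x y a b c d ↔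
      ∃ α β γ, α * (x * a + y * b) + β * (x * c + y * d) + γ * (a * d - b * c) = q :=
  Submodule.mem_span_triple

/-- The linear form `t * x - r * y` is a nonzerodivisor modulo `minorIdeal x y a b c d`, provided
that the matrix is generic enough on the hyperplane `t * x = r * y`; the endomorphism `e` plays the
role of the restriction to this hyperplane, on which `(x, y) = (r * w, t * w)`. -/
theorem mem_minorIdeal_of_mul_mem {R : Type*} [CommRing R] [IsDomain R] [DecompositionMonoid R]
    {x y a b c d : R} (r t w : R) (e : R →+* R) (hl : t * x - r * y ≠ 0)
    (he : ∀ u, t * x - r * y ∣ u - e u)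
    (hx : e x = e r * w) (hy : e y = e t * w) (hw : w ≠ 0)
    (hm : e (r * a + t * b) ≠ 0)
    (hrel : IsRelPrime (e (r * a + t * b)) (e (r * c + t * d)))
    (hreg : ∀ γ, γ * (a * d - b * c) ∈ Ideal.span {x, y} → γ ∈ Ideal.span {x, y})
    {q : R} (hq : (t * x - r * y) * q ∈ minorIdeal x y a b c d) :
    q ∈ minorIdeal x y a b c d := by
  obtain ⟨α, β, γ, h⟩ := mem_minorIdeal.1 hq
  obtain ⟨γ₁, γ₂, rfl⟩ := Ideal.mem_span_pair.1 <| hreg γ <| Ideal.mem_span_pair.2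
    ⟨t * q - α * a - β * c, -(r * q) - α * b - β * d, by linear_combination -h⟩
  set α' := α + γ₁ * d - γ₂ * c with hα'
  set β' := β - γ₁ * b + γ₂ * a with hβ'
  have h' : α' * (x * a + y * b) + β' * (x * c + y * d) = (t * x - r * y) * q := by
    rw [← h, hα', hβ']
    ring
  have h0 : e α' * e (r * a + t * b) + e β' * e (r * c + t * d) = 0 := by
    have := congrArg e h'
    simp only [map_add, map_mul, map_sub, hx, hy] at this ⊢
    refine (mul_eq_zero.1 (?_ : w * _ = 0)).resolve_left hw
    linear_combination this
  obtain ⟨k, hk⟩ : e (r * a + t * b) ∣ e β' :=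
    hrel.dvd_of_dvd_mul_right ⟨-e α', by linear_combination h0⟩
  have hk' : e α' = -k * e (r * c + t * d) := by
    refine mul_left_cancel₀ hm ?_
    linear_combination h0 - e (r * c + t * d) * hk
  obtain ⟨u₁, hu₁⟩ := he α'
  obtain ⟨u₂, hu₂⟩ := he β'
  obtain ⟨u₃, hu₃⟩ := he (r * a + t * b)
  obtain ⟨u₄, hu₄⟩ := he (r * c + t * d)
  refine mem_minorIdeal.2 ⟨u₁ + k * u₄, u₂ - k * u₃, -k, mul_left_cancel₀ hl ?_⟩
  rw [← h']
  linear_combination (-(x * a + y * b)) * (hu₁ + hk' + k * hu₄) -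
    (x * c + y * d) * (hu₂ + hk - k * hu₃)

/-- Substitution of `v` for the variables of the coefficient ring. -/
noncomputable def coeffSubst {k σ τ : Type*} [CommRing k] (v : σ → MvPolynomial σ k) :
    MvPolynomial τ (MvPolynomial σ k) →+* MvPolynomial τ (MvPolynomial σ k) :=
  MvPolynomial.map (aeval v : MvPolynomial σ k →ₐ[k] MvPolynomial σ k).toRingHom

@[simp]
theorem coeffSubst_X {k σ τ : Type*} [CommRing k] (v : σ → MvPolynomial σ k) (i : τ) :
    coeffSubst v (X i : MvPolynomial τ (MvPolynomial σ k)) = X i := by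
  simp [coeffSubst]

@[simp]
theorem coeffSubst_C_X {k σ τ : Type*} [CommRing k] (v : σ → MvPolynomial σ k) (i : σ) :
    coeffSubst v (C (X i) : MvPolynomial τ (MvPolynomial σ k)) = C (v i) := by
  simp [coeffSubst]

theorem sub_coeffSubst_mem {k σ τ : Type*} [CommRing k] (v : σ → MvPolynomial σ k)
    (K : Ideal (MvPolynomial τ (MvPolynomial σ k))) (hK : ∀ i, C (X i) - C (v i) ∈ K)
    (u : MvPolynomial τ (MvPolynomial σ k)) : u - coeffSubst v u ∈ K := by
  have h : Ideal.Quotient.mk K = (Ideal.Quotient.mk K).comp (coeffSubst v) := by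
    refine MvPolynomial.ringHom_ext' (MvPolynomial.ringHom_ext (fun r => ?_) (fun i => ?_))
      (fun i => ?_)
    · simp [coeffSubst]
    · simpa [coeffSubst] using Ideal.Quotient.eq.2 (hK i)
    · simp
  exact Ideal.Quotient.eq.1 (RingHom.congr_fun h u)

theorem isRelPrime_C_of_isUnit_coeff {A σ : Type*} [CommRing A] [IsDomain A] {a : A} (ha : a ≠ 0)
    {p : MvPolynomial σ A} (m : σ →₀ ℕ) (hp : IsUnit (p.coeff m)) : IsRelPrime (C a) p := by
  intro q hqa hqp
  obtain ⟨b, -, rfl⟩ := (dvd_C_iff_exists ha).1 hqa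
  exact (isUnit_of_dvd_unit (C_dvd_iff_dvd_coeff _ _ |>.1 hqp m) hp).map C

theorem isRelPrime_X_of_eval {A σ : Type*} [CommRing A] [IsDomain A] {i : σ}
    {p : MvPolynomial σ A} (v : σ → A) (hv : v i = 0) (hp : eval v p ≠ 0) :
    IsRelPrime (X i) p := by
  refine (X_prime (i := i)).irreducible.isRelPrime_iff_not_dvd.2 ?_
  rintro ⟨q, rfl⟩
  simp [hv] at hp

theorem isRelPrime_C_C {A σ : Type*} [CommRing A] [IsDomain A] {a b : A} (ha : a ≠ 0)
    (h : IsRelPrime a b) : IsRelPrime (C a : MvPolynomial σ A) (C b) := by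
  intro q hqa hqb
  obtain ⟨c, hca, rfl⟩ := (dvd_C_iff_exists ha).1 hqa
  exact (h hca (by simpa using (C_dvd_iff_dvd_coeff _ _).1 hqb 0)).map C

section FourLines

local notation "𝐱" => (C (X 0) : MvPolynomial (Fin 4) (MvPolynomial (Fin 3) ℂ))
local notation "𝐲" => (C (X 1) : MvPolynomial (Fin 4) (MvPolynomial (Fin 3) ℂ))
local notation "𝐳" => (C (X 2) : MvPolynomial (Fin 4) (MvPolynomial (Fin 3) ℂ))
local notation "𝐬" => (X 0 : MvPolynomial (Fin 4) (MvPolynomial (Fin 3) ℂ))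
local notation "ξ₁" => (X 1 : MvPolynomial (Fin 4) (MvPolynomial (Fin 3) ℂ))
local notation "ξ₂" => (X 2 : MvPolynomial (Fin 4) (MvPolynomial (Fin 3) ℂ))
local notation "ξ₃" => (X 3 : MvPolynomial (Fin 4) (MvPolynomial (Fin 3) ℂ))

/-- The maximal minors of the Hilbert–Burch matrix of the kernel after eliminating `s`. -/
noncomputable def fourLinesMinorIdeal : Ideal (MvPolynomial (Fin 4) (MvPolynomial (Fin 3) ℂ)) :=
  minorIdeal 𝐱 𝐲 (4 * ξ₃ - 𝐲 * ξ₁) (4 * 𝐳 * ξ₃ - 𝐲 * ξ₂)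
    (𝐱 * ξ₁ + 3 * 𝐲 * (ξ₁ - ξ₂) + 4 * (𝐳 - 1) * ξ₃) (-(𝐲 * ξ₂))

theorem fourLines_mem_span_of_mul_mem (γ : MvPolynomial (Fin 4) (MvPolynomial (Fin 3) ℂ))
    (h : γ * ((4 * ξ₃ - 𝐲 * ξ₁) * (-(𝐲 * ξ₂)) - (4 * 𝐳 * ξ₃ - 𝐲 * ξ₂) *
      (𝐱 * ξ₁ + 3 * 𝐲 * (ξ₁ - ξ₂) + 4 * (𝐳 - 1) * ξ₃)) ∈ Ideal.span {𝐱, 𝐲}) :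
    γ ∈ Ideal.span {𝐱, 𝐲} := by
  let e := coeffSubst (k := ℂ) (τ := Fin 4) ![0, 0, X 2]
  have he : e γ = 0 := by
    obtain ⟨u, v, huv⟩ := Ideal.mem_span_pair.1 h
    have := congrArg e huv
    simp only [e, map_add, map_mul, map_sub, map_neg, map_one, map_ofNat, coeffSubst_X,
      coeffSubst_C_X, Matrix.cons_val, map_zero] at this
    have hz : 𝐳 - 1 ≠ 0 := fun h => by
      have := congrArg (fun p => eval (fun _ => (0 : ℂ)) (eval (fun _ => 0) p)) h
      simp at this
    have hne : 4 * 𝐳 * ξ₃ * (4 * (𝐳 - 1) * ξ₃) ≠ 0 := by simp [hz]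
    refine (mul_eq_zero.1 ?_).resolve_right hne
    linear_combination this
  have := sub_coeffSubst_mem (k := ℂ) (τ := Fin 4) ![0, 0, X 2] (Ideal.span {𝐱, 𝐲})
    (fun i => by
      fin_cases i
      · simpa using Ideal.subset_span (by simp)
      · simpa using Ideal.subset_span (by simp)
      · simp) γ
  simpa [e, he] using this

theorem isUnit_ofNat_mvPolynomial (n : ℕ) [n.AtLeastTwo] :
    IsUnit (OfNat.ofNat n : MvPolynomial (Fin 4) (MvPolynomial (Fin 3) ℂ)) := by
  have h : IsUnit (OfNat.ofNat n : ℂ) := (OfNat.ofNat_ne_zero n).isUnit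
  have := h.map ((C : MvPolynomial (Fin 3) ℂ →+* MvPolynomial (Fin 4) _).comp C)
  rwa [map_ofNat] at this

theorem mem_fourLinesMinorIdeal_of_y_mul_mem {q : MvPolynomial (Fin 4) (MvPolynomial (Fin 3) ℂ)}
    (hq : 𝐲 * q ∈ fourLinesMinorIdeal) : q ∈ fourLinesMinorIdeal := by
  have hl : 0 * 𝐱 - (-1) * 𝐲 = 𝐲 := by ring
  refine mem_minorIdeal_of_mul_mem (-1) 0 (-𝐱) (coeffSubst ![X 0, 0, X 2]) (by simp)
    (fun u => ?_) (by simp; ring) (by simp) (by simp) (by simp [map_ofNat]) ?_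
    fourLines_mem_span_of_mul_mem
    (by rwa [hl])
  · rw [hl]
    refine Ideal.mem_span_singleton.1 (sub_coeffSubst_mem _ _ (fun i => ?_) u)
    fin_cases i <;> simp
  · have h : IsRelPrime ξ₃ (𝐱 * ξ₁) := (isRelPrime_C_of_isUnit_coeff (by simp)
      (Finsupp.single 3 1) (by simp)).symm.mul_right (isRelPrime_X_of_eval ![1, 1, 1, 0] rfl
        (by simp))
    have h4 : IsRelPrime (4 * ξ₃) (𝐱 * ξ₁ + 4 * ξ₃ * (𝐳 - 1)) :=
      ((isUnit_ofNat_mvPolynomial 4).isRelPrime_left.mul_left h).add_mul_left_right _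
    convert h4.neg_neg using 1 <;> simp [map_ofNat] <;> ring

theorem mem_fourLinesMinorIdeal_of_x_mul_mem {q : MvPolynomial (Fin 4) (MvPolynomial (Fin 3) ℂ)}
    (hq : 𝐱 * q ∈ fourLinesMinorIdeal) : q ∈ fourLinesMinorIdeal := by
  have hl : 1 * 𝐱 - 0 * 𝐲 = 𝐱 := by ring
  have h : IsRelPrime (4 * 𝐳 * ξ₃) (𝐲 * ξ₂) := by
    refine .mul_left (.mul_left (isUnit_ofNat_mvPolynomial 4).isRelPrime_left
      (.mul_right ?_ ?_)) (.mul_right ?_ ?_)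
    · exact isRelPrime_C_C (by simp) (isRelPrime_X_of_eval ![1, 1, 0] rfl (by simp))
    · exact isRelPrime_C_of_isUnit_coeff (by simp) (Finsupp.single 2 1) (by simp)
    · exact (isRelPrime_C_of_isUnit_coeff (by simp) (Finsupp.single 3 1) (by simp)).symm
    · exact isRelPrime_X_of_eval ![1, 1, 1, 0] rfl (by simp)
  have h' : IsRelPrime (4 * 𝐳 * ξ₃ - 𝐲 * ξ₂) (-(𝐲 * ξ₂)) := by
    simpa [sub_eq_add_neg] using (h.neg_right.add_mul_left_left 1)
  refine mem_minorIdeal_of_mul_mem 0 1 𝐲 (coeffSubst ![0, X 1, X 2]) (by simp)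
    (fun u => ?_) (by simp) (by simp) (by simp) ?_ ?_ fourLines_mem_span_of_mul_mem
    (by rwa [hl])
  · rw [hl]
    refine Ideal.mem_span_singleton.1 (sub_coeffSubst_mem _ _ (fun i => ?_) u)
    fin_cases i <;> simp
  · intro h0
    have := congrArg (fun p => eval (fun _ => (1 : ℂ)) (eval ![0, 0, 1, 0] p)) h0
    simp at this
  · convert h' using 1 <;> simp [map_ofNat]

theorem mem_fourLinesMinorIdeal_of_x_add_y_mul_mem
    {q : MvPolynomial (Fin 4) (MvPolynomial (Fin 3) ℂ)}
    (hq : (𝐱 + 𝐲) * q ∈ fourLinesMinorIdeal) : q ∈ fourLinesMinorIdeal := by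
  have hl : 1 * 𝐱 - (-1) * 𝐲 = 𝐱 + 𝐲 := by ring
  have hz : (X 2 - 1 : MvPolynomial (Fin 3) ℂ) ≠ 0 := fun h => by
    have := congrArg (eval (fun _ => (0 : ℂ))) h
    simp at this
  have hyz : IsRelPrime (C (X 2 - 1)) 𝐲 :=
    isRelPrime_C_C hz (isRelPrime_X_of_eval ![1, 0, 0] rfl (by simp)).symm
  have h : IsRelPrime (4 * C (X 2 - 1) * ξ₃) (𝐲 * (ξ₁ - ξ₂)) := by
    refine .mul_left (.mul_left (isUnit_ofNat_mvPolynomial 4).isRelPrime_left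
      (.mul_right hyz ?_)) (.mul_right ?_ ?_)
    · exact isRelPrime_C_of_isUnit_coeff hz (Finsupp.single 1 1)
        (by simp [coeff_X, Finsupp.single_left_inj])
    · exact (isRelPrime_C_of_isUnit_coeff (by simp) (Finsupp.single 3 1) (by simp)).symm
    · exact isRelPrime_X_of_eval ![1, 1, 0, 0] rfl (by simp)
  have h' := ((h.add_mul_right_left 1).neg_right).add_mul_left_right (-1)
  refine mem_minorIdeal_of_mul_mem (-1) 1 𝐲 (coeffSubst ![-X 1, X 1, X 2]) ?_
    (fun u => ?_) (by simp; ring) (by simp) (by simp) ?_ ?_ fourLines_mem_span_of_mul_mem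
    (by rwa [hl])
  · intro h0
    have := congrArg (fun p => eval (fun _ => (1 : ℂ)) (eval (fun _ => 0) p)) h0
    norm_num at this
  · rw [hl]
    refine Ideal.mem_span_singleton.1 (sub_coeffSubst_mem _ _ (fun i => ?_) u)
    fin_cases i <;> simp
  · intro h0
    have := congrArg (fun p => eval (fun _ => (1 : ℂ)) (eval ![0, 1, 0, 0] p)) h0
    simp at this
  · convert h' using 1 <;> simp [map_ofNat] <;> ring

theorem pderiv_zero_fourLines : pderiv 0 fourLines =
    X 1 * (X 0 + X 1) * (X 0 + X 1 * X 2) + X 0 * X 1 * (X 0 + X 1 * X 2) +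
      X 0 * X 1 * (X 0 + X 1) := by
  simp [fourLines, pderiv_X]
  ring

theorem pderiv_one_fourLines : pderiv 1 fourLines =
    X 0 * (X 0 + X 1) * (X 0 + X 1 * X 2) + X 0 * X 1 * (X 0 + X 1 * X 2) +
      X 0 * X 1 * (X 0 + X 1) * X 2 := by
  simp [fourLines, pderiv_X]
  ring

theorem pderiv_two_fourLines : pderiv 2 fourLines = X 1 * (X 0 * (X 1 * (X 0 + X 1))) := by
  simp [fourLines, pderiv_X]
  ring

/-- The ideal generated by the three syzygies dual to a basis of the logarithmic derivations. -/
noncomputable def fourLinesLinearIdeal : Ideal (MvPolynomial (Fin 4) (MvPolynomial (Fin 3) ℂ)) :=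
  Ideal.span {𝐱 * ξ₁ + 𝐲 * ξ₂ - 4 * 𝐬, (𝐱 + 𝐲 * 𝐳) * ξ₃ - 𝐲 * 𝐬,
    𝐱 ^ 2 * ξ₁ - 𝐲 ^ 2 * ξ₂ + 𝐱 * (𝐳 - 1) * ξ₃ - 3 * (𝐱 - 𝐲) * 𝐬}

theorem mem_fourLinesLinearIdeal {q : MvPolynomial (Fin 4) (MvPolynomial (Fin 3) ℂ)} :
    q ∈ fourLinesLinearIdeal ↔ ∃ a b c, a * (𝐱 * ξ₁ + 𝐲 * ξ₂ - 4 * 𝐬) +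
      b * ((𝐱 + 𝐲 * 𝐳) * ξ₃ - 𝐲 * 𝐬) +
      c * (𝐱 ^ 2 * ξ₁ - 𝐲 ^ 2 * ξ₂ + 𝐱 * (𝐳 - 1) * ξ₃ - 3 * (𝐱 - 𝐲) * 𝐬) = q :=
  Submodule.mem_span_triple

theorem mem_kerOne_of_linear {A : Type*} [CommRing A] {n : ℕ} (f : A) (g : Fin n → A)
    (a : Fin (n + 1) → A) {p : MvPolynomial (Fin (n + 1)) A} (hp : p = ∑ i, C (a i) * X i)
    (h : a 0 * f + ∑ j : Fin n, a j.succ * g j = 0) : p ∈ kerOne f g := by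
  subst hp
  refine Ideal.subset_span ⟨?_, IsHomogeneous.sum _ _ _ fun i _ => isHomogeneous_C_mul_X _ _⟩
  have := congrArg (fun r => Polynomial.C r * Polynomial.X) h
  rw [RingHom.mem_ker, reesPhi, map_sum, Fin.sum_univ_succ]
  simpa [add_mul, Finset.sum_mul, mul_assoc, Polynomial.algebraMap_eq] using this

theorem fourLinesLinearIdeal_le :
    fourLinesLinearIdeal ≤ kerOne fourLines fun j => pderiv j fourLines := by
  refine Ideal.span_le.2 ?_
  rintro _ (rfl | rfl | rfl)
  · refine mem_kerOne_of_linear _ _ ![-4, X 0, X 1, 0] ?_ ?_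
    · simp [Fin.sum_univ_succ, map_ofNat]
      ring
    · simp [Fin.sum_univ_succ, pderiv_zero_fourLines, pderiv_one_fourLines]
      rw [fourLines]
      ring
  · refine mem_kerOne_of_linear _ _ ![-X 1, 0, 0, X 0 + X 1 * X 2] ?_ ?_
    · simp [Fin.sum_univ_succ]
      ring
    · simp [Fin.sum_univ_succ, pderiv_two_fourLines]
      rw [fourLines]
      ring
  · refine mem_kerOne_of_linear _ _ ![-3 * (X 0 - X 1), X 0 ^ 2, -X 1 ^ 2, X 0 * (X 2 - 1)] ?_ ?_
    · simp [Fin.sum_univ_succ, map_ofNat]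
      ring
    · simp [Fin.sum_univ_succ, pderiv_zero_fourLines, pderiv_one_fourLines, pderiv_two_fourLines]
      rw [fourLines]
      ring

theorem exists_pow_mul_mem_fourLinesLinearIdeal
    {p : MvPolynomial (Fin 4) (MvPolynomial (Fin 3) ℂ)}
    (hp : reesPhi fourLines (fun j => pderiv j fourLines) p = 0) :
    ∃ N : ℕ, (𝐲 * (𝐱 * (𝐲 * (𝐱 + 𝐲)))) ^ N * p ∈ fourLinesLinearIdeal := by
  let G : Fin 4 → MvPolynomial (Fin 3) ℂ := Fin.cons fourLines fun j => pderiv j fourLines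
  have hG : (fun i => Polynomial.C (G i) * Polynomial.X) = (Fin.cons
      (Polynomial.C fourLines * Polynomial.X)
      fun j => Polynomial.C (pderiv j fourLines) * Polynomial.X : Fin 4 → _) := by
    funext i
    refine Fin.cases ?_ (fun j => ?_) i <;> simp [G]
  have h3 : G 3 = X 1 * (X 0 * (X 1 * (X 0 + X 1))) := pderiv_two_fourLines
  have hI : ∀ i, C (G 3) * X i - C (G i) * X 3 ∈ fourLinesLinearIdeal := by
    intro i
    rw [mem_fourLinesLinearIdeal, h3]
    fin_cases i
    · refine ⟨0, -(𝐱 * 𝐲 * (𝐱 + 𝐲)), 0, ?_⟩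
      change _ = _ - C fourLines * _
      simp [fourLines]
      ring
    · refine ⟨𝐲 ^ 3, -((3 * 𝐱 + 𝐲) * 𝐲), 𝐲 ^ 2, ?_⟩
      change _ = _ - C (pderiv 0 fourLines) * _
      simp [pderiv_zero_fourLines]
      ring
    · refine ⟨𝐱 ^ 2 * 𝐲, -((𝐱 + 3 * 𝐲) * 𝐱), -(𝐱 * 𝐲), ?_⟩
      change _ = _ - C (pderiv 1 fourLines) * _
      simp [pderiv_one_fourLines]
      ring
    · exact ⟨0, 0, 0, by simp [h3]⟩
  obtain ⟨N, hN⟩ := exists_C_pow_mul_mem_of_aeval_eq_zero G 3 fourLinesLinearIdeal hI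
    (p := p) (by rw [hG]; exact hp)
  exact ⟨N, by simpa [h3] using hN⟩

/-- Elimination of `s` by means of the Euler relation `4 * s = x * ξ₁ + y * ξ₂`. -/
noncomputable def eulerElim :
    MvPolynomial (Fin 4) (MvPolynomial (Fin 3) ℂ) →ₐ[MvPolynomial (Fin 3) ℂ]
      MvPolynomial (Fin 4) (MvPolynomial (Fin 3) ℂ) :=
  aeval ![C (C (1 / 4)) * (𝐱 * ξ₁ + 𝐲 * ξ₂), ξ₁, ξ₂, ξ₃]

theorem C_C_quarter_mul_four :
    (C (C (1 / 4)) * 4 : MvPolynomial (Fin 4) (MvPolynomial (Fin 3) ℂ)) = 1 := by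
  have h := congrArg (fun r : ℂ => (C (C r) : MvPolynomial (Fin 4) (MvPolynomial (Fin 3) ℂ)))
    (show (1 / 4 : ℂ) * 4 = 1 by norm_num)
  simpa only [map_mul, map_ofNat, map_one] using h

theorem sub_eulerElim_mem (p : MvPolynomial (Fin 4) (MvPolynomial (Fin 3) ℂ)) :
    p - eulerElim p ∈ fourLinesLinearIdeal := by
  have h : Ideal.Quotient.mk fourLinesLinearIdeal =
      (Ideal.Quotient.mk fourLinesLinearIdeal).comp eulerElim.toRingHom := by
    refine MvPolynomial.ringHom_ext (fun r => ?_) (fun i => ?_)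
    · simp [eulerElim]
    · refine Ideal.Quotient.eq.2 ?_
      fin_cases i
      · refine mem_fourLinesLinearIdeal.2 ⟨-C (C (1 / 4)), 0, 0, ?_⟩
        simp only [eulerElim, AlgHom.toRingHom_eq_coe, RingHom.coe_coe, aeval_X, Fin.zero_eta,
          Matrix.cons_val]
        linear_combination 𝐬 * C_C_quarter_mul_four
      all_goals simp [eulerElim]
  exact Ideal.Quotient.eq.1 (RingHom.congr_fun h p)

theorem eulerElim_mem {p : MvPolynomial (Fin 4) (MvPolynomial (Fin 3) ℂ)}
    (hp : p ∈ fourLinesLinearIdeal) : eulerElim p ∈ fourLinesMinorIdeal := by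
  obtain ⟨a, b, c, rfl⟩ := mem_fourLinesLinearIdeal.1 hp
  refine mem_minorIdeal.2 ⟨C (C (1 / 4)) * eulerElim b, C (C (1 / 4)) * eulerElim c, 0, ?_⟩
  have hC : ∀ r, eulerElim (C r) = C r := fun r => by simp [eulerElim]
  have h0 : eulerElim 𝐬 = C (C (1 / 4)) * (𝐱 * ξ₁ + 𝐲 * ξ₂) := by simp [eulerElim]
  have h1 : eulerElim ξ₁ = ξ₁ := by simp [eulerElim]
  have h2 : eulerElim ξ₂ = ξ₂ := by simp [eulerElim]
  have h3 : eulerElim ξ₃ = ξ₃ := by simp [eulerElim]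
  simp only [map_add, map_sub, map_mul, map_pow, map_ofNat, map_one, hC, h0, h1, h2, h3]
  linear_combination (eulerElim a * (𝐱 * ξ₁ + 𝐲 * ξ₂) + eulerElim b * (𝐱 + 𝐲 * 𝐳) * ξ₃ +
    eulerElim c * (𝐱 ^ 2 * ξ₁ - 𝐲 ^ 2 * ξ₂ + 𝐱 * (𝐳 - 1) * ξ₃)) * C_C_quarter_mul_four

theorem x_mul_mem_fourLinesLinearIdeal {q : MvPolynomial (Fin 4) (MvPolynomial (Fin 3) ℂ)}
    (hq : q ∈ fourLinesMinorIdeal) : 𝐱 * q ∈ fourLinesLinearIdeal := by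
  obtain ⟨α, β, γ, rfl⟩ := mem_minorIdeal.1 hq
  set u := 𝐱 * α - γ * (𝐲 * ξ₂) with hu
  set v := 𝐱 * β - γ * (4 * 𝐳 * ξ₃ - 𝐲 * ξ₂) with hv
  refine mem_fourLinesLinearIdeal.2 ⟨-(u * 𝐲) - 3 * v * (𝐱 - 𝐲), 4 * u, 4 * v, ?_⟩
  rw [hu, hv]
  ring

theorem mem_fourLinesMinorIdeal_of_pow_mul_mem (N : ℕ)
    {q : MvPolynomial (Fin 4) (MvPolynomial (Fin 3) ℂ)}
    (hq : (𝐲 * (𝐱 * (𝐲 * (𝐱 + 𝐲)))) ^ N * q ∈ fourLinesMinorIdeal) :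
    q ∈ fourLinesMinorIdeal := by
  induction N with
  | zero => simpa using hq
  | succ N ih =>
    simp only [pow_succ', mul_assoc] at hq ih
    exact ih <| mem_fourLinesMinorIdeal_of_x_add_y_mul_mem <|
      mem_fourLinesMinorIdeal_of_y_mul_mem <| mem_fourLinesMinorIdeal_of_x_mul_mem <|
      mem_fourLinesMinorIdeal_of_y_mul_mem hq

theorem kerOne_le_ker {A : Type*} [CommRing A] {n : ℕ} (f : A) (g : Fin n → A) :
    kerOne f g ≤ RingHom.ker (reesPhi f g) :=
  Ideal.span_le.2 fun _ h => h.1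

end FourLines

/-- For the "four lines" divisor, with `g_j = ∂f/∂x_j`, one has
`ker φ = (ker^{(1)}φ : f)`: a polynomial `p ∈ A[s, ξ_1, ξ_2, ξ_3]` lies in `ker φ` if and
only if `f·p ∈ ker^{(1)}φ` (here `f` is regarded as a constant polynomial). -/
theorem fourLines_ker_eq_colon :
    ∀ p : MvPolynomial (Fin 4) (MvPolynomial (Fin 3) ℂ),
      p ∈ RingHom.ker (reesPhi fourLines fun j => pderiv j fourLines) ↔
        C fourLines * p ∈ kerOne fourLines fun j => pderiv j fourLines := by
  intro p
  refine ⟨fun hp => fourLinesLinearIdeal_le ?_, fun hp => ?_⟩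
  · obtain ⟨N, hN⟩ := exists_pow_mul_mem_fourLinesLinearIdeal hp
    have hmem := eulerElim_mem hN
    rw [map_mul, map_pow] at hmem
    have hx : C (X 0) * p ∈ fourLinesLinearIdeal := by
      have hq := x_mul_mem_fourLinesLinearIdeal
        (mem_fourLinesMinorIdeal_of_pow_mul_mem N (q := eulerElim p) (by
          simpa [eulerElim] using hmem))
      have := add_mem hq (Ideal.mul_mem_left _ (C (X 0)) (sub_eulerElim_mem p))
      rwa [← mul_add, add_sub_cancel] at this
    have hf : C fourLines * p =
        C (X 1 * (X 0 + X 1) * (X 0 + X 1 * X 2)) * (C (X 0) * p) := by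
      rw [← mul_assoc, ← map_mul, fourLines]
      congr 2
      ring
    rw [hf]
    exact Ideal.mul_mem_left _ _ hx
  · have h := kerOne_le_ker _ _ hp
    rw [RingHom.mem_ker, map_mul] at h
    refine (mul_eq_zero.1 h).resolve_left ?_
    have hf : fourLines ≠ 0 := fun h0 => by
      have := congrArg (eval (fun _ => (1 : ℂ))) h0
      norm_num [fourLines] at this
    simpa [reesPhi, Polynomial.algebraMap_eq] using hf
end
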